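/- arXiv:1210.0190 — 2 statements merged into one kernel-verified Lean document; each statement's English description precedes it below -/
import Mathlib

section
/- Let W be a finite-dimensional 𝔤-module over k with a decomposition W = ⊕_{γ∈Γ} W_γ into irreducible 𝔤-submodules and a decomposition W ⊗_k F = ⊕_{α∈A} V_α into irreducible (𝔤 ⊗_k F)-submodules. Call α, α' ∈ A equivalent if there exist σ, τ ∈ S with σ(V_α) ≅ τ(V_{α'}); let α₁, …, α_t be representatives of the equivalence classes, and for each i choose γ(i) ∈ Γ with V_{α_i} ⊆ W_{γ(i)} ⊗_k F, and set W_i := W_{γ(i)}, D_i := End_𝔤(W_i), and m_i := (Σ_{α' equivalent to α_i} dim_F V_{α'}) / dim_k W_i. Then the 𝔤-modules W₁, …, W_t are pairwise non-isomorphic, each D_i is a division k-algebra, each m_i is a positive integer, and there is an isomorphism of k-algebras End_𝔤(W) ≅ ∏_{i=1}^{t} Mat_{m_i × m_i}(D_i). -/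
open scoped TensorProduct

section

variable (k F : Type*) [Field k] [Field F] [Algebra k F]

private lemma galMap_aux (σ : F ≃ₐ[k] F) (W : Type*) [AddCommGroup W] [Module k W]
    (c : F) (x : F ⊗[k] W) :
    LinearMap.rTensor W σ.toLinearMap (c • x) = σ c • LinearMap.rTensor W σ.toLinearMap x := by
  induction x using TensorProduct.induction_on with
  | zero => simp
  | tmul f w => simp [TensorProduct.smul_tmul', smul_eq_mul, map_mul]
  | add x y hx hy => rw [smul_add, map_add, map_add, smul_add, hx, hy]

/-- The `σ`-semilinear Galois action `id_W ⊗ σ` on the base change `F ⊗[k] W`. -/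
noncomputable def galMap (σ : F ≃ₐ[k] F) (W : Type*) [AddCommGroup W] [Module k W] :
    (F ⊗[k] W) →ₛₗ[(σ.toRingEquiv : F →+* F)] (F ⊗[k] W) where
  toFun := LinearMap.rTensor W σ.toLinearMap
  map_add' := map_add _
  map_smul' := galMap_aux k F σ W

/-- The image `σ(V)` of an `F`-subspace of `F ⊗[k] W` under the Galois action:
again an `F`-subspace. -/
noncomputable def galSub (σ : F ≃ₐ[k] F) {W : Type*} [AddCommGroup W] [Module k W]
    (V : Submodule F (F ⊗[k] W)) : Submodule F (F ⊗[k] W) :=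
  Submodule.map (galMap k F σ W) V

variable (𝔤 : Type*) [LieRing 𝔤] [LieAlgebra k 𝔤]

/-- `σ(V_α)` and `τ(V_β)` are isomorphic as `(𝔤 ⊗_k F)`-modules; since the Galois
images are a priori only `F`-subspaces, we phrase this via the (unique) Lie submodules
having these subspaces as underlying `F`-subspaces. -/
def GalConjIso (σ τ : F ≃ₐ[k] F)
    {W₁ W₂ : Type*} [AddCommGroup W₁] [Module k W₁] [LieRingModule 𝔤 W₁] [LieModule k 𝔤 W₁]
    [AddCommGroup W₂] [Module k W₂] [LieRingModule 𝔤 W₂] [LieModule k 𝔤 W₂]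
    (Vα : LieSubmodule F (F ⊗[k] 𝔤) (F ⊗[k] W₁))
    (Vβ : LieSubmodule F (F ⊗[k] 𝔤) (F ⊗[k] W₂)) : Prop :=
  ∃ (Vα' : LieSubmodule F (F ⊗[k] 𝔤) (F ⊗[k] W₁))
    (Vβ' : LieSubmodule F (F ⊗[k] 𝔤) (F ⊗[k] W₂)),
    (Vα' : Submodule F (F ⊗[k] W₁)) = galSub k F σ (Vα : Submodule F (F ⊗[k] W₁)) ∧
    (Vβ' : Submodule F (F ⊗[k] W₂)) = galSub k F τ (Vβ : Submodule F (F ⊗[k] W₂)) ∧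
    Nonempty (Vα' ≃ₗ⁅F, F ⊗[k] 𝔤⁆ Vβ')

/-- A Lie module is semisimple if it is a direct sum of irreducible submodules. -/
def IsSemisimpleLieModule (R L M : Type*) [CommRing R] [LieRing L] [LieAlgebra R L]
    [AddCommGroup M] [Module R M] [LieRingModule L M] : Prop :=
  ∃ (ι : Type) (p : ι → LieSubmodule R L M),
    (∀ i, IsAtom (p i)) ∧ iSupIndep p ∧ (⨆ i, p i) = ⊤

end
/-- The `k`-algebra of `𝔤`-module endomorphisms of a Lie module `M`,
as a subalgebra of `Module.End k M`. -/
def lieEnd (k 𝔤 M : Type*) [Field k] [LieRing 𝔤] [LieAlgebra k 𝔤]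
    [AddCommGroup M] [Module k M] [LieRingModule 𝔤 M] [LieModule k 𝔤 M] :
    Subalgebra k (Module.End k M) where
  carrier := {f | ∀ (x : 𝔤) (m : M), f ⁅x, m⁆ = ⁅x, f m⁆}
  mul_mem' := fun hf hg x m => by
    simp only [Module.End.mul_apply, hg x m, hf x]
  add_mem' := fun hf hg x m => by
    simp only [LinearMap.add_apply, hf x m, hg x m, lie_add]
  one_mem' := fun x m => rfl
  zero_mem' := fun x m => by simp
  algebraMap_mem' := fun c x m => by
    simp [Module.algebraMap_end_apply, lie_smul]

section LieModuleDecomposition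

variable {R L M M' : Type*} [Field R] [LieRing L]
  [AddCommGroup M] [Module R M] [LieRingModule L M]
  [AddCommGroup M'] [Module R M'] [LieRingModule L M']

lemma LieSubmodule.exists_mem_ne_zero_of_ne_bot (P : LieSubmodule R L M) (hP : P ≠ ⊥) :
    ∃ v ∈ P, v ≠ 0 := by
  by_contra! h
  exact hP ((LieSubmodule.eq_bot_iff P).mpr h)

/-- **Schur's lemma** for irreducible Lie submodules. -/
lemma LieModuleHom.bijective_of_isAtom {P : LieSubmodule R L M} {Q : LieSubmodule R L M'}
    (hP : IsAtom P) (hQ : IsAtom Q) (f : P →ₗ⁅R,L⁆ Q) (hf : f ≠ 0) :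
    Function.Bijective f := by
  have mem_map : ∀ x : P, x ∈ f.ker ↔ (x : M) ∈ f.ker.map P.incl := fun x =>
    ⟨fun hx => ⟨x, hx, rfl⟩, fun ⟨y, hy, hyx⟩ => (Subtype.ext hyx : y = x) ▸ hy⟩
  have mem_map' : ∀ x : Q, x ∈ f.range ↔ (x : M') ∈ f.range.map Q.incl := fun x =>
    ⟨fun hx => ⟨x, hx, rfl⟩, fun ⟨y, hy, hyx⟩ => (Subtype.ext hyx : y = x) ▸ hy⟩
  constructor
  · rw [← LieModuleHom.ker_eq_bot, LieSubmodule.eq_bot_iff]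
    intro x hx
    rcases hP.le_iff.mp (LieSubmodule.map_incl_le (N' := f.ker)) with h | h
    · rw [mem_map, h] at hx
      simpa using hx
    · refine absurd (LieModuleHom.ext fun y => ?_) hf
      exact (mem_map y).mpr (by rw [h]; exact y.2)
  · rw [← LieModuleHom.range_eq_top, eq_top_iff]
    intro x _
    rcases hQ.le_iff.mp (LieSubmodule.map_incl_le (N' := f.range)) with h | h
    · refine absurd (LieModuleHom.ext fun y => ?_) hf
      have hy : f y ∈ f.range := ⟨y, rfl⟩
      rw [mem_map', h] at hy
      simpa using hy
    · rw [mem_map', h]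
      exact x.2

lemma LieModuleHom.nonempty_equiv_of_isAtom {P : LieSubmodule R L M} {Q : LieSubmodule R L M'}
    (hP : IsAtom P) (hQ : IsAtom Q) (f : P →ₗ⁅R,L⁆ Q) (hf : f ≠ 0) :
    Nonempty (P ≃ₗ⁅R,L⁆ Q) :=
  ⟨{ LinearEquiv.ofBijective (f : P →ₗ[R] Q) (f.bijective_of_isAtom hP hQ hf) with
      map_lie' := fun {x m} => f.map_lie x m }⟩

/-- Nonzero independent Lie submodules of a finite-dimensional module are finite in number. -/
lemma LieSubmodule.finite_of_iSupIndep_of_isAtom [Module.Finite R M] {ι : Type*}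
    {N : ι → LieSubmodule R L M} (hN : ∀ i, IsAtom (N i)) (hind : iSupIndep N) : Finite ι := by
  have h := Submodule.finite_ne_bot_of_iSupIndep
    ((LieSubmodule.iSupIndep_toSubmodule).mpr hind)
  rw [← Set.finite_univ_iff]
  refine h.subset fun i _ => ?_
  simpa using (hN i).1

/-- The projections attached to a direct sum decomposition into Lie submodules. -/
lemma LieSubmodule.exists_projections {ι : Type*} [Fintype ι]
    {N : ι → LieSubmodule R L M} (hind : iSupIndep N) (hsup : ⨆ i, N i = ⊤) :
    ∃ p : ∀ i, M →ₗ⁅R,L⁆ N i, (∀ i (x : N i), p i x = x) ∧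
      (∀ i j (x : N j), i ≠ j → p i x = 0) ∧ ∀ v, ∑ i, (p i v : M) = v := by
  classical
  have hint : DirectSum.IsInternal fun i => (N i : Submodule R M) :=
    DirectSum.isInternal_submodule_of_iSupIndep_of_iSup_eq_top
      (LieSubmodule.iSupIndep_toSubmodule.mpr hind)
      (by rw [← LieSubmodule.iSup_toSubmodule, hsup, LieSubmodule.top_toSubmodule])
  let D := hint.chooseDecomposition
  let q : ∀ i, M →ₗ[R] N i := fun i =>
    DirectSum.component R ι (fun i => N i) i ∘ₗ
      (DirectSum.decomposeLinearEquiv fun i => (N i : Submodule R M)).toLinearMap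
  have hq1 : ∀ i (x : N i), q i x = x := fun i x => by
    change DirectSum.decompose (fun i => (N i : Submodule R M)) (x : M) i = x
    exact Subtype.ext (DirectSum.decompose_of_mem_same _ x.2)
  have hq2 : ∀ i j (x : N j), i ≠ j → q i x = 0 := fun i j x hij => by
    change DirectSum.decompose (fun i => (N i : Submodule R M)) (x : M) i = 0
    exact Subtype.ext (DirectSum.decompose_of_mem_ne _ x.2 hij.symm)
  have hq3 : ∀ v, ∑ i, (q i v : M) = v := fun v => by
    change ∑ i, (DirectSum.decompose (fun i => (N i : Submodule R M)) v i : M) = v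
    conv_rhs => rw [← DirectSum.sum_support_decompose (fun i => (N i : Submodule R M)) v]
    refine (Finset.sum_subset (Finset.subset_univ _) fun i _ hi => ?_).symm
    simpa using hi
  have hsum : ∀ (f : ∀ j, N j) i, q i (∑ j, (f j : M)) = f i := fun f i => by
    rw [map_sum, Finset.sum_eq_single i (fun j _ hj => hq2 i j _ hj.symm) (by simp), hq1]
  refine ⟨fun i => { q i with map_lie' := fun {x v} => ?_ }, hq1, hq2, hq3⟩
  change q i ⁅x, v⁆ = ⁅x, q i v⁆
  conv_lhs => rw [← hq3 v, lie_sum]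
  exact hsum (fun j => ⁅x, q j v⁆) i

lemma LieSubmodule.finrank_eq_sum [Module.Finite R M] {ι : Type*} [Fintype ι]
    {N : ι → LieSubmodule R L M} (hind : iSupIndep N) (hsup : ⨆ i, N i = ⊤) :
    Module.finrank R M = ∑ i, Module.finrank R (N i) := by
  obtain ⟨p, hp₁, hp₂, hp₃⟩ := LieSubmodule.exists_projections hind hsup
  rw [← Module.finrank_pi_fintype]
  refine LinearEquiv.finrank_eq (LinearEquiv.ofBijective
    (LinearMap.pi fun i => (p i : M →ₗ[R] N i)) ⟨fun v w h => ?_, fun f => ?_⟩)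
  · rw [← hp₃ v, ← hp₃ w]
    exact Finset.sum_congr rfl fun i _ => congr(($h i : M))
  · refine ⟨∑ j, (f j : M), funext fun i => ?_⟩
    change p i (∑ j, (f j : M)) = f i
    rw [map_sum, Finset.sum_eq_single i (fun j _ hj => hp₂ i j _ hj.symm) (by simp), hp₁]

end LieModuleDecomposition

section ExtendScalars

variable {k F 𝔤 M N : Type*} [Field k] [Field F] [Algebra k F] [LieRing 𝔤] [LieAlgebra k 𝔤]
  [AddCommGroup M] [Module k M] [LieRingModule 𝔤 M] [LieModule k 𝔤 M]
  [AddCommGroup N] [Module k N] [LieRingModule 𝔤 N] [LieModule k 𝔤 N]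

private lemma tensor_zero_lie (v : F ⊗[k] M) : ⁅(0 : F ⊗[k] 𝔤), v⁆ = 0 := zero_lie v

private lemma tensor_add_lie (x y : F ⊗[k] 𝔤) (v : F ⊗[k] M) : ⁅x + y, v⁆ = ⁅x, v⁆ + ⁅y, v⁆ :=
  add_lie x y v

variable (F) in
/-- Extension of scalars of a homomorphism of Lie modules. -/
noncomputable def LieModuleHom.extendScalars (f : M →ₗ⁅k,𝔤⁆ N) :
    F ⊗[k] M →ₗ⁅F,F ⊗[k] 𝔤⁆ F ⊗[k] N :=
  { (f : M →ₗ[k] N).baseChange F with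
    map_lie' := fun {x v} => by
      change (f : M →ₗ[k] N).baseChange F ⁅x, v⁆ = ⁅x, (f : M →ₗ[k] N).baseChange F v⁆
      induction x using TensorProduct.induction_on with
      | zero => rw [tensor_zero_lie, tensor_zero_lie, map_zero]
      | add x y hx hy => rw [tensor_add_lie, map_add, hx, hy, tensor_add_lie]
      | tmul a x =>
        induction v using TensorProduct.induction_on with
        | zero => simp
        | add v w hv hw => rw [lie_add, map_add, hv, hw, map_add, lie_add]
        | tmul b w => simp }

@[simp]
lemma LieModuleHom.extendScalars_tmul (f : M →ₗ⁅k,𝔤⁆ N) (a : F) (w : M) :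
    f.extendScalars F (a ⊗ₜ w) = a ⊗ₜ f w := rfl

lemma LieModuleHom.extendScalars_eq_of_leftInverse {f : M →ₗ⁅k,𝔤⁆ N} {g : N →ₗ⁅k,𝔤⁆ M}
    (h : Function.LeftInverse g f) (y : F ⊗[k] M) :
    g.extendScalars F (f.extendScalars F y) = y := by
  induction y using TensorProduct.induction_on with
  | zero => simp
  | add v w hv hw => rw [map_add, map_add, hv, hw]
  | tmul a w => rw [extendScalars_tmul, extendScalars_tmul, h]

lemma LieModuleHom.extendScalars_comp {N' : Type*} [AddCommGroup N'] [Module k N']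
    [LieRingModule 𝔤 N'] [LieModule k 𝔤 N'] (g : N →ₗ⁅k,𝔤⁆ N') (f : M →ₗ⁅k,𝔤⁆ N)
    (y : F ⊗[k] M) :
    (g.comp f).extendScalars F y = g.extendScalars F (f.extendScalars F y) := by
  induction y using TensorProduct.induction_on with
  | zero => simp
  | add v w hv hw => rw [map_add, map_add, map_add, hv, hw]
  | tmul a w => rfl

lemma LieSubmodule.exists_extendScalars_incl_eq {P : LieSubmodule k 𝔤 M} {y : F ⊗[k] M}
    (hy : y ∈ P.baseChange F) : ∃ z : F ⊗[k] P, P.incl.extendScalars F z = y :=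
  hy

/-- A nonzero `k`-linear map between base changes that commutes with `𝔤` yields a nonzero
homomorphism of the original Lie modules. -/
lemma exists_lieModuleHom_ne_zero (g : F ⊗[k] M →ₗ[k] F ⊗[k] N)
    (hg : ∀ (x : 𝔤) v, g ⁅(1 : F) ⊗ₜ[k] x, v⁆ = ⁅(1 : F) ⊗ₜ[k] x, g v⁆) (hne : g ≠ 0) :
    ∃ f : M →ₗ⁅k,𝔤⁆ N, f ≠ 0 := by
  classical
  let b := Module.Basis.ofVectorSpace k F
  let e := TensorProduct.equivFinsuppOfBasisLeft (N := N) b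
  have he : ∀ i (x : 𝔤) y, e ⁅(1 : F) ⊗ₜ[k] x, y⁆ i = ⁅x, e y i⁆ := fun i x y => by
    induction y using TensorProduct.induction_on with
    | zero => simp
    | add v w hv hw => simp only [lie_add, map_add, Finsupp.add_apply, hv, hw]
    | tmul a w => simp [e]
  obtain ⟨c, w, hcw⟩ : ∃ c w, g (c ⊗ₜ w) ≠ 0 := by
    by_contra! h
    exact hne (TensorProduct.ext' h)
  obtain ⟨i, hi⟩ : ∃ i, e (g (c ⊗ₜ w)) i ≠ 0 := by
    by_contra! h
    exact hcw (e.map_eq_zero_iff.mp (Finsupp.ext h))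
  let f : M →ₗ[k] N := Finsupp.lapply i ∘ₗ e.toLinearMap ∘ₗ g ∘ₗ TensorProduct.mk k F M c
  refine ⟨{ f with map_lie' := fun {x v} => ?_ }, fun h => hi (congr($h w) :)⟩
  change e (g (c ⊗ₜ ⁅x, v⁆)) i = ⁅x, e (g (c ⊗ₜ v)) i⁆
  rw [← he, ← hg, LieAlgebra.ExtendScalars.bracket_tmul, one_mul]

end ExtendScalars

section Galois

variable {k F 𝔤 W : Type*} [Field k] [Field F] [Algebra k F] [LieRing 𝔤] [LieAlgebra k 𝔤]
  [AddCommGroup W] [Module k W] [LieRingModule 𝔤 W] [LieModule k 𝔤 W]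

lemma galMap_tmul (σ : F ≃ₐ[k] F) (a : F) (w : W) :
    galMap k F σ W (a ⊗ₜ w) = σ a ⊗ₜ w := rfl

lemma galMap_lie_tmul (σ : F ≃ₐ[k] F) (a : F) (x : 𝔤) (v : F ⊗[k] W) :
    galMap k F σ W ⁅a ⊗ₜ[k] x, v⁆ = ⁅σ a ⊗ₜ[k] x, galMap k F σ W v⁆ := by
  induction v using TensorProduct.induction_on with
  | zero => rw [lie_zero, map_zero, lie_zero]
  | add v w hv hw => rw [lie_add, map_add, hv, hw, map_add, lie_add]
  | tmul b w =>
    simp only [LieAlgebra.ExtendScalars.bracket_tmul, galMap_tmul, map_mul]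

lemma galMap_symm_galMap (σ : F ≃ₐ[k] F) (v : F ⊗[k] W) :
    galMap k F σ.symm W (galMap k F σ W v) = v := by
  induction v using TensorProduct.induction_on with
  | zero => rw [map_zero, map_zero]
  | add v w hv hw => rw [map_add, map_add, hv, hw]
  | tmul b w => rw [galMap_tmul, galMap_tmul, AlgEquiv.symm_apply_apply]

lemma galMap_galMap_symm (σ : F ≃ₐ[k] F) (v : F ⊗[k] W) :
    galMap k F σ W (galMap k F σ.symm W v) = v :=
  galMap_symm_galMap σ.symm v

variable (k 𝔤) in
/-- The Galois image of a Lie submodule of `F ⊗[k] W`. -/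
noncomputable def galLieSub (σ : F ≃ₐ[k] F) (V : LieSubmodule F (F ⊗[k] 𝔤) (F ⊗[k] W)) :
    LieSubmodule F (F ⊗[k] 𝔤) (F ⊗[k] W) :=
  { galSub k F σ (V : Submodule F (F ⊗[k] W)) with
    lie_mem := by
      rintro x _ ⟨v, hv, rfl⟩
      change ⁅x, galMap k F σ W v⁆ ∈ galSub k F σ (V : Submodule F (F ⊗[k] W))
      induction x using TensorProduct.induction_on with
      | zero => rw [tensor_zero_lie]; exact zero_mem _
      | add x y hx hy => rw [tensor_add_lie]; exact add_mem hx hy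
      | tmul a x =>
        refine ⟨⁅σ.symm a ⊗ₜ[k] x, v⁆, V.lie_mem hv, ?_⟩
        rw [galMap_lie_tmul, AlgEquiv.apply_symm_apply] }

lemma mem_galLieSub {σ : F ≃ₐ[k] F} {V : LieSubmodule F (F ⊗[k] 𝔤) (F ⊗[k] W)}
    {v : F ⊗[k] W} : v ∈ galLieSub k 𝔤 σ V ↔ galMap k F σ.symm W v ∈ V :=
  ⟨fun ⟨u, hu, h⟩ => by rw [← h, galMap_symm_galMap]; exact hu,
    fun h => ⟨_, h, galMap_galMap_symm σ v⟩⟩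

lemma isAtom_galLieSub (σ : F ≃ₐ[k] F) {V : LieSubmodule F (F ⊗[k] 𝔤) (F ⊗[k] W)}
    (hV : IsAtom V) : IsAtom (galLieSub k 𝔤 σ V) := by
  let e : LieSubmodule F (F ⊗[k] 𝔤) (F ⊗[k] W) ≃o LieSubmodule F (F ⊗[k] 𝔤) (F ⊗[k] W) :=
    { toFun := galLieSub k 𝔤 σ
      invFun := galLieSub k 𝔤 σ.symm
      left_inv := fun V => by
        ext; rw [mem_galLieSub, mem_galLieSub, AlgEquiv.symm_symm, galMap_symm_galMap]
      right_inv := fun V => by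
        ext; rw [mem_galLieSub, mem_galLieSub, AlgEquiv.symm_symm, galMap_galMap_symm]
      map_rel_iff' := fun {U V} => by
        refine ⟨fun h v hv => ?_, fun h v hv => mem_galLieSub.mpr (h (mem_galLieSub.mp hv))⟩
        have hv' : galMap k F σ W v ∈ galLieSub k 𝔤 σ U := ⟨v, hv, rfl⟩
        have hv'' := mem_galLieSub.mp (h hv')
        rwa [galMap_symm_galMap] at hv'' }
  exact (e.isAtom_iff V).mpr hV

lemma galLieSub_one (V : LieSubmodule F (F ⊗[k] 𝔤) (F ⊗[k] W)) : galLieSub k 𝔤 1 V = V := by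
  have h : ∀ v : F ⊗[k] W, galMap k F 1 W v = v := fun v => by
    induction v using TensorProduct.induction_on with
    | zero => rw [map_zero]
    | add v w hv hw => rw [map_add, hv, hw]
    | tmul b w => rfl
  exact le_antisymm (fun v ⟨u, hu, huv⟩ => huv ▸ (h u).symm ▸ hu) fun v hv => ⟨v, hv, h v⟩

/-- Galois conjugate modules are isomorphic over `k`. -/
lemma GalConjIso.exists_linearEquiv {σ τ : F ≃ₐ[k] F}
    {V V' : LieSubmodule F (F ⊗[k] 𝔤) (F ⊗[k] W)} (h : GalConjIso k F 𝔤 σ τ V V') :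
    ∃ χ : V ≃ₗ[k] V', ∀ (x : 𝔤) v, χ ⁅(1 : F) ⊗ₜ[k] x, v⁆ = ⁅(1 : F) ⊗ₜ[k] x, χ v⁆ := by
  have key : ∀ (ρ : F ≃ₐ[k] F) (U U' : LieSubmodule F (F ⊗[k] 𝔤) (F ⊗[k] W)),
      (U' : Submodule F (F ⊗[k] W)) = galSub k F ρ (U : Submodule F (F ⊗[k] W)) →
      ∃ χ : U ≃ₗ[k] U', ∀ (x : 𝔤) v, χ ⁅(1 : F) ⊗ₜ[k] x, v⁆ = ⁅(1 : F) ⊗ₜ[k] x, χ v⁆ := by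
    intro ρ U U' hU
    obtain rfl : U' = galLieSub k 𝔤 ρ U := LieSubmodule.toSubmodule_injective hU
    let f : U →ₗ[k] galLieSub k 𝔤 ρ U :=
      { toFun := fun v => ⟨galMap k F ρ W v, ⟨v, v.2, rfl⟩⟩
        map_add' := fun v w => Subtype.ext (map_add _ _ _)
        map_smul' := fun c v => Subtype.ext
          (map_smul (LinearMap.rTensor W ρ.toLinearMap) c (v : F ⊗[k] W)) }
    let g : galLieSub k 𝔤 ρ U → U := fun v => ⟨galMap k F ρ.symm W v, mem_galLieSub.mp v.2⟩
    refine ⟨{ f with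
      invFun := g
      left_inv := fun v => Subtype.ext (galMap_symm_galMap _ _)
      right_inv := fun v => Subtype.ext (galMap_galMap_symm _ _) }, fun x v => Subtype.ext ?_⟩
    change galMap k F ρ W ⁅(1 : F) ⊗ₜ[k] x, (v : F ⊗[k] W)⁆ =
      ⁅(1 : F) ⊗ₜ[k] x, galMap k F ρ W (v : F ⊗[k] W)⁆
    rw [galMap_lie_tmul, map_one]
  obtain ⟨U, U', hU, hU', ⟨e⟩⟩ := h
  obtain ⟨χ₁, h₁⟩ := key σ V U hU
  obtain ⟨χ₂, h₂⟩ := key τ V' U' hU'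
  refine ⟨χ₁ ≪≫ₗ (e.toLinearEquiv.restrictScalars k) ≪≫ₗ χ₂.symm, fun x v => ?_⟩
  apply χ₂.injective
  change χ₂ (χ₂.symm (e (χ₁ _))) = χ₂ ⁅_, χ₂.symm (e (χ₁ _))⁆
  rw [h₂, LinearEquiv.apply_symm_apply, LinearEquiv.apply_symm_apply, h₁]
  exact e.toLieModuleHom.map_lie _ _

/-- The Galois trace of a suitable multiple of `y ≠ 0` is a nonzero element defined over `k`. -/
lemma exists_sum_galMap_smul_eq_tmul [FiniteDimensional k F] [IsGalois k F]
    {P : LieSubmodule k 𝔤 W} {y : F ⊗[k] W} (hy : y ∈ P.baseChange F) (hne : y ≠ 0) :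
    ∃ c : F, ∃ w ∈ P, w ≠ 0 ∧ ∑ σ : F ≃ₐ[k] F, galMap k F σ W (c • y) = 1 ⊗ₜ w := by
  let T : F ⊗[k] W →ₗ[k] W :=
    (TensorProduct.lid k W).toLinearMap ∘ₗ LinearMap.rTensor W (Algebra.trace k F)
  have hT : ∀ y, ∑ σ : F ≃ₐ[k] F, galMap k F σ W y = 1 ⊗ₜ T y := fun y => by
    induction y using TensorProduct.induction_on with
    | zero => simp only [map_zero, Finset.sum_const_zero, TensorProduct.tmul_zero]
    | add v w hv hw => simp only [map_add, Finset.sum_add_distrib, hv, hw, TensorProduct.tmul_add]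
    | tmul a w =>
      simp only [galMap_tmul, ← TensorProduct.sum_tmul, ← trace_eq_sum_automorphisms]
      simp [T, TensorProduct.tmul_smul, Algebra.algebraMap_eq_smul_one, TensorProduct.smul_tmul']
  have hTP : ∀ z : F ⊗[k] P, T (P.incl.extendScalars F z) ∈ P := fun z => by
    induction z using TensorProduct.induction_on with
    | zero => simp
    | add v w hv hw => rw [map_add, map_add]; exact add_mem hv hw
    | tmul a w => exact P.smul_mem _ w.2
  obtain ⟨c, hc⟩ : ∃ c : F, T (c • y) ≠ 0 := by
    classical
    let b := Module.Basis.ofVectorSpace k W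
    let e := TensorProduct.equivFinsuppOfBasisRight (M := F) b
    have he : ∀ (c : F) y i, b.repr (T (c • y)) i = Algebra.trace k F (c * e y i) := fun c y i => by
      induction y using TensorProduct.induction_on with
      | zero => simp
      | add v w hv hw => simp only [smul_add, map_add, Finsupp.add_apply, hv, hw, mul_add]
      | tmul a w => simp [T, e, TensorProduct.smul_tmul', mul_comm]
    by_contra! h
    refine hne (e.map_eq_zero_iff.mp (Finsupp.ext fun i => ?_))
    refine (traceForm_nondegenerate k F).2 _ fun c => ?_
    rw [Algebra.traceForm_apply, ← he, h, map_zero, Finsupp.zero_apply]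
  obtain ⟨z, hz⟩ := LieSubmodule.exists_extendScalars_incl_eq ((P.baseChange F).smul_mem c hy)
  exact ⟨c, T (c • y), hz ▸ hTP z, hc, hT _⟩

end Galois

section MatrixDecomposition

variable {k 𝔤 W : Type*} [Field k] [LieRing 𝔤] [LieAlgebra k 𝔤]
  [AddCommGroup W] [Module k W] [LieRingModule 𝔤 W] [LieModule k 𝔤 W]

lemma lieEnd_isUnit_of_isAtom {P : LieSubmodule k 𝔤 W} (hP : IsAtom P) (d : lieEnd k 𝔤 P)
    (hd : d ≠ 0) : IsUnit d := by
  let f : P →ₗ⁅k,𝔤⁆ P := { (d : Module.End k P) with map_lie' := fun {x v} => d.2 x v }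
  have hf : Function.Bijective f := f.bijective_of_isAtom hP hP fun h =>
    hd (Subtype.ext (LinearMap.ext fun v => congr($h v)))
  let e : P ≃ₗ[k] P := LinearEquiv.ofBijective (d : Module.End k P) hf
  have he : ∀ v, (d : Module.End k P) (e.symm v) = v := e.apply_symm_apply
  let d' : lieEnd k 𝔤 P := ⟨e.symm.toLinearMap, fun x v => hf.1 <| by
    change (d : Module.End k P) (e.symm ⁅x, v⁆) = (d : Module.End k P) ⁅x, e.symm v⁆
    rw [he, d.2, he]⟩
  exact ⟨⟨d, d', Subtype.ext (LinearMap.ext he),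
    Subtype.ext (LinearMap.ext e.symm_apply_apply)⟩, rfl⟩

/-- The endomorphism algebra of a direct sum of powers of Lie modules `U i` without nonzero
homomorphisms between them is a product of matrix algebras. -/
lemma nonempty_lieEnd_algEquiv_pi_matrix {ι : Type*} [Fintype ι] [DecidableEq ι] (m : ι → ℕ)
    (U : ι → LieSubmodule k 𝔤 W) (s : ∀ i, Fin (m i) → (U i →ₗ⁅k,𝔤⁆ W))
    (q : ∀ i, Fin (m i) → (W →ₗ⁅k,𝔤⁆ U i)) (hqs : ∀ i a x, q i a (s i a x) = x)
    (hqs' : ∀ i a b x, a ≠ b → q i a (s i b x) = 0)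
    (hom : ∀ i j, i ≠ j → ∀ f : U i →ₗ⁅k,𝔤⁆ U j, f = 0)
    (hsum : ∀ w, ∑ i, ∑ a, s i a (q i a w) = w) :
    Nonempty (lieEnd k 𝔤 W ≃ₐ[k]
      ((i : ι) → Matrix (Fin (m i)) (Fin (m i)) (lieEnd k 𝔤 (U i)))) := by
  let toHom : lieEnd k 𝔤 W → (W →ₗ⁅k,𝔤⁆ W) := fun f =>
    { (f : Module.End k W) with map_lie' := fun {x v} => f.2 x v }
  let entry : lieEnd k 𝔤 W → ∀ i, Matrix (Fin (m i)) (Fin (m i)) (lieEnd k 𝔤 (U i)) :=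
    fun f i a b => ⟨(q i a : W →ₗ[k] U i) ∘ₗ (f : Module.End k W) ∘ₗ (s i b : U i →ₗ[k] W),
      fun x v => ((q i a).comp ((toHom f).comp (s i b))).map_lie x v⟩
  have key : ∀ (f : lieEnd k 𝔤 W) i a w,
      q i a ((f : Module.End k W) w) = ∑ b, (entry f i a b : Module.End k (U i)) (q i b w) := by
    intro f i a w
    conv_lhs => rw [← hsum w]
    simp only [map_sum]
    refine Finset.sum_eq_single i (fun j _ hj => Finset.sum_eq_zero fun b _ => ?_) (by simp)
    exact congr($(hom j i hj ((q i a).comp ((toHom f).comp (s j b)))) (q j b w))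
  let assemble : (∀ i, Matrix (Fin (m i)) (Fin (m i)) (lieEnd k 𝔤 (U i))) → lieEnd k 𝔤 W :=
    fun M => ⟨∑ i, ∑ a, ∑ b, (s i a : U i →ₗ[k] W) ∘ₗ (M i a b : Module.End k (U i)) ∘ₗ
      (q i b : W →ₗ[k] U i), fun x w => by
        simp only [LinearMap.sum_apply, lie_sum]
        refine Finset.sum_congr rfl fun i _ => Finset.sum_congr rfl fun a _ =>
          Finset.sum_congr rfl fun b _ => ?_
        change s i a ((M i a b : Module.End k (U i)) (q i b ⁅x, w⁆)) =
          ⁅x, s i a ((M i a b : Module.End k (U i)) (q i b w))⁆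
        rw [LieModuleHom.map_lie, (M i a b).2, LieModuleHom.map_lie]⟩
  have hassemble : ∀ M w, (assemble M : Module.End k W) w =
      ∑ i, ∑ a, s i a (∑ b, (M i a b : Module.End k (U i)) (q i b w)) := fun M w => by
    simp [assemble, LinearMap.sum_apply]
  have hcross : ∀ i j a b x, i ≠ j → q i a (s j b x) = 0 := fun i j a b x hij =>
    congr($(hom j i hij.symm ((q i a).comp (s j b))) x)
  have hpick : ∀ (v : ∀ i, Fin (m i) → U i) i a, q i a (∑ j, ∑ b, s j b (v j b)) = v i a := by
    intro v i a
    simp only [map_sum]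
    rw [Finset.sum_eq_single i
      (fun j _ hj => Finset.sum_eq_zero fun b _ => hcross i j a b _ hj.symm) (by simp),
      Finset.sum_eq_single a (fun b _ hb => hqs' i a b _ hb.symm) (by simp), hqs]
  refine ⟨AlgEquiv.ofLinearEquiv
    { toFun := entry
      map_add' := fun f g => ?_
      map_smul' := fun c f => ?_
      invFun := assemble
      left_inv := fun f => ?_
      right_inv := fun M => ?_ } ?_ fun f g => ?_⟩
  · funext i a b
    exact Subtype.ext (LinearMap.ext fun x => (q i a).map_add _ _)
  · funext i a b
    exact Subtype.ext (LinearMap.ext fun x => (q i a).map_smul _ _)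
  · refine Subtype.ext (LinearMap.ext fun w => ?_)
    simp only [hassemble, ← key, hsum]
  · funext i a b
    refine Subtype.ext (LinearMap.ext fun x => ?_)
    change q i a ((assemble M : Module.End k W) (s i b x)) = _
    rw [hassemble, hpick (fun j c => ∑ d, (M j c d : Module.End k (U j)) (q j d (s i b x))),
      Finset.sum_eq_single b (fun d _ hd => by rw [hqs' i d b _ hd, map_zero]) (by simp), hqs]
  · funext i a b
    refine Subtype.ext (LinearMap.ext fun x => ?_)
    change q i a (s i b x) = ((1 : Matrix (Fin (m i)) (Fin (m i)) (lieEnd k 𝔤 (U i))) a b :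
      Module.End k (U i)) x
    by_cases hab : a = b
    · subst hab
      rw [hqs, Matrix.one_apply_eq]; rfl
    · rw [hqs' i a b x hab, Matrix.one_apply_ne hab]; rfl
  · funext i a b
    refine Subtype.ext (LinearMap.ext fun x => ?_)
    change q i a ((f : Module.End k W) ((g : Module.End k W) (s i b x))) =
      ((entry f i * entry g i) a b : Module.End k (U i)) x
    rw [key, Matrix.mul_apply]
    simp only [AddSubmonoidClass.coe_finsetSum, LinearMap.sum_apply]
    rfl

end MatrixDecomposition

section Descent

variable {k F 𝔤 W : Type*} [Field k] [Field F] [Algebra k F] [FiniteDimensional k F]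
  [IsGalois k F] [LieRing 𝔤] [LieAlgebra k 𝔤]
  [AddCommGroup W] [Module k W] [LieRingModule 𝔤 W] [LieModule k 𝔤 W]

/-- An irreducible `P` has base change generated by the Galois images of any nonzero submodule:
a homomorphism vanishing on all these images vanishes on the base change. -/
lemma extendScalars_eq_zero_of_forall_galMap {M : Type*} [AddCommGroup M] [Module F M]
    [LieRingModule (F ⊗[k] 𝔤) M] {P : LieSubmodule k 𝔤 W} (hP : IsAtom P)
    {V : LieSubmodule F (F ⊗[k] 𝔤) (F ⊗[k] W)} (hV : V ≠ ⊥) (hVP : V ≤ P.baseChange F)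
    (ψ : F ⊗[k] W →ₗ⁅F,F ⊗[k] 𝔤⁆ M)
    (hψ : ∀ σ : F ≃ₐ[k] F, ∀ v ∈ V, ψ (galMap k F σ W v) = 0) :
    ∀ y ∈ P.baseChange F, ψ y = 0 := by
  obtain ⟨v, hv, hv0⟩ := V.exists_mem_ne_zero_of_ne_bot hV
  obtain ⟨c, w, hwP, hw0, hw⟩ := exists_sum_galMap_smul_eq_tmul (hVP hv) hv0
  let K : LieSubmodule k 𝔤 W :=
    { carrier := {w | ψ (1 ⊗ₜ w) = 0}
      add_mem' := fun {a b} ha hb => by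
        change ψ _ = 0 at ha hb
        change ψ _ = 0
        rw [TensorProduct.tmul_add, map_add, ha, hb, add_zero]
      zero_mem' := by
        change ψ _ = 0
        rw [TensorProduct.tmul_zero, map_zero]
      smul_mem' := fun a b hb => by
        change ψ _ = 0 at hb
        change ψ _ = 0
        rw [TensorProduct.tmul_smul, ← algebraMap_smul F a, map_smul, hb, smul_zero]
      lie_mem := fun {x b} hb => by
        change ψ _ = 0 at hb
        change ψ _ = 0
        rw [← one_mul (1 : F), ← LieAlgebra.ExtendScalars.bracket_tmul, LieModuleHom.map_lie, hb,
          lie_zero] }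
  have hwK : w ∈ K := by
    change ψ _ = 0
    rw [← hw, map_sum]
    exact Finset.sum_eq_zero fun σ _ => hψ σ _ (V.smul_mem c hv)
  have hPK : P ≤ K := by
    rcases hP.le_iff.mp (inf_le_left : P ⊓ K ≤ P) with h | h
    · have : w ∈ P ⊓ K := ⟨hwP, hwK⟩
      rw [h] at this
      exact absurd ((LieSubmodule.mem_bot w).mp this) hw0
    · exact inf_eq_left.mp h
  intro y hy
  obtain ⟨z, rfl⟩ := LieSubmodule.exists_extendScalars_incl_eq hy
  induction z using TensorProduct.induction_on with
  | zero => rw [map_zero, map_zero]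
  | add v w hv hw =>
    rw [map_add, map_add, hv (by exact ⟨v, rfl⟩), hw (by exact ⟨w, rfl⟩), add_zero]
  | tmul a w =>
    have hw : ψ (1 ⊗ₜ (w : W)) = 0 := hPK w.2
    have : P.incl.extendScalars F (a ⊗ₜ w) = a • ((1 : F) ⊗ₜ[k] (w : W)) := by
      simp [TensorProduct.smul_tmul']
    rw [this, map_smul, hw, smul_zero]

/-- If `P` and `Q` are isomorphic and irreducible, irreducible submodules of their base changes
are Galois conjugate. -/
lemma galConjIso_of_equiv {P Q : LieSubmodule k 𝔤 W} (hP : IsAtom P) (p : W →ₗ⁅k,𝔤⁆ P)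
    (hp : ∀ x : P, p x = x) (φ : P ≃ₗ⁅k,𝔤⁆ Q)
    {V V' : LieSubmodule F (F ⊗[k] 𝔤) (F ⊗[k] W)} (hV : IsAtom V) (hV' : IsAtom V')
    (hVP : V ≤ P.baseChange F) (hVQ : V' ≤ Q.baseChange F)
    (π : F ⊗[k] W →ₗ⁅F,F ⊗[k] 𝔤⁆ V') (hπ : ∀ x : V', π x = x) :
    ∃ σ τ : F ≃ₐ[k] F, GalConjIso k F 𝔤 σ τ V V' := by
  let ψ : F ⊗[k] W →ₗ⁅F,F ⊗[k] 𝔤⁆ V' :=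
    π.comp ((Q.incl.comp (φ.toLieModuleHom.comp p)).extendScalars F)
  by_contra hno
  have hz : ∀ σ : F ≃ₐ[k] F, ∀ v ∈ V, ψ (galMap k F σ W v) = 0 := by
    intro σ v hv
    by_contra hne
    have hmem : galMap k F σ W v ∈ galLieSub k 𝔤 σ V := ⟨v, hv, rfl⟩
    obtain ⟨e⟩ := LieModuleHom.nonempty_equiv_of_isAtom (isAtom_galLieSub σ hV) hV'
      (ψ.comp (galLieSub k 𝔤 σ V).incl) fun h => hne congr($h ⟨_, hmem⟩)
    exact hno ⟨σ, 1, galLieSub k 𝔤 σ V, V', rfl,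
      congrArg LieSubmodule.toSubmodule (galLieSub_one V').symm, ⟨e⟩⟩
  have hzero := extendScalars_eq_zero_of_forall_galMap hP hV.1 hVP ψ hz
  obtain ⟨v', hv', hv0⟩ := V'.exists_mem_ne_zero_of_ne_bot hV'.1
  obtain ⟨z, hzv⟩ := LieSubmodule.exists_extendScalars_incl_eq (hVQ hv')
  have h := hzero (P.incl.extendScalars F (φ.symm.toLieModuleHom.extendScalars F z)) ⟨_, rfl⟩
  change π ((Q.incl.comp (φ.toLieModuleHom.comp p)).extendScalars F _) = 0 at h
  rw [LieModuleHom.extendScalars_comp, LieModuleHom.extendScalars_comp,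
    LieModuleHom.extendScalars_eq_of_leftInverse (f := P.incl) hp,
    LieModuleHom.extendScalars_eq_of_leftInverse
      (f := φ.symm.toLieModuleHom) (g := φ.toLieModuleHom) φ.apply_symm_apply, hzv,
    hπ ⟨v', hv'⟩] at h
  exact hv0 congr(($h : F ⊗[k] W))

end Descent

set_option maxHeartbeats 1000000 in
/-- Wedderburn-type decomposition of `End_𝔤(W)` obtained by Galois
descent from the decomposition of `W ⊗_k F` into irreducibles. -/
theorem stmt5
    (k F : Type*) [Field k] [Field F] [Algebra k F] [FiniteDimensional k F] [IsGalois k F]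
    (𝔤 : Type*) [LieRing 𝔤] [LieAlgebra k 𝔤] [Module.Finite k 𝔤]
    (W : Type*)
    [AddCommGroup W] [Module k W] [LieRingModule 𝔤 W] [LieModule k 𝔤 W] [Module.Finite k W]
    (Γ A : Type)
    (Wfam : Γ → LieSubmodule k 𝔤 W)
    (hWatom : ∀ γ, IsAtom (Wfam γ)) (hWindep : iSupIndep Wfam) (hWsup : (⨆ γ, Wfam γ) = ⊤)
    (Vfam : A → LieSubmodule F (F ⊗[k] 𝔤) (F ⊗[k] W))
    (hVatom : ∀ α, IsAtom (Vfam α)) (hVindep : iSupIndep Vfam) (hVsup : (⨆ α, Vfam α) = ⊤)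
    -- the Galois-conjugacy equivalence relation on `A`
    (Rel : A → A → Prop)
    (hRel : ∀ α α', Rel α α' ↔ ∃ σ τ : F ≃ₐ[k] F, GalConjIso k F 𝔤 σ τ (Vfam α) (Vfam α'))
    -- representatives `α₁, …, α_t` of the equivalence classes
    (t : ℕ) (rep : Fin t → A) (hrep : ∀ α : A, ∃! i : Fin t, Rel α (rep i))
    -- for each `i`, a `γ(i)` with `V_{α_i} ⊆ W_{γ(i)} ⊗_k F`
    (γfun : Fin t → Γ) (hγfun : ∀ i, Vfam (rep i) ≤ (Wfam (γfun i)).baseChange F)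
    -- the multiplicities `m_i`
    (m : Fin t → ℕ)
    (hm : ∀ i, m i = (∑ᶠ α ∈ {α' : A | Rel (rep i) α'}, Module.finrank F ↥(Vfam α))
        / Module.finrank k ↥(Wfam (γfun i))) :
    -- the `W_i` are pairwise non-isomorphic
    (∀ i j : Fin t, i ≠ j → IsEmpty (↥(Wfam (γfun i)) ≃ₗ⁅k, 𝔤⁆ ↥(Wfam (γfun j)))) ∧
    -- each `D_i = End_𝔤(W_i)` is a division algebra
    (∀ i : Fin t, ∀ d : lieEnd k 𝔤 ↥(Wfam (γfun i)), d ≠ 0 → IsUnit d) ∧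
    -- each `m_i` is a positive integer
    (∀ i : Fin t, 0 < m i ∧
      Module.finrank k ↥(Wfam (γfun i))
        ∣ ∑ᶠ α ∈ {α' : A | Rel (rep i) α'}, Module.finrank F ↥(Vfam α)) ∧
    -- `End_𝔤(W) ≅ ∏_i Mat_{m_i × m_i}(D_i)` as `k`-algebras
    Nonempty (lieEnd k 𝔤 W ≃ₐ[k]
      ((i : Fin t) → Matrix (Fin (m i)) (Fin (m i)) (lieEnd k 𝔤 ↥(Wfam (γfun i))))) := by
  classical
  have : Finite Γ := LieSubmodule.finite_of_iSupIndep_of_isAtom hWatom hWindep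
  have : Finite A := LieSubmodule.finite_of_iSupIndep_of_isAtom hVatom hVindep
  have := Fintype.ofFinite Γ
  have := Fintype.ofFinite A
  obtain ⟨p, hp₁, hp₂, hp₃⟩ := LieSubmodule.exists_projections hWindep hWsup
  obtain ⟨π, hπ₁, hπ₂, hπ₃⟩ := LieSubmodule.exists_projections hVindep hVsup
  have rel_refl : ∀ α, Rel α α := fun α =>
    (hRel α α).mpr ⟨1, 1, galLieSub k 𝔤 1 (Vfam α), galLieSub k 𝔤 1 (Vfam α), rfl, rfl,
      ⟨LieModuleEquiv.refl⟩⟩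
  have rel_symm : ∀ α β, Rel α β → Rel β α := fun α β h => by
    obtain ⟨σ, τ, U, U', hU, hU', ⟨e⟩⟩ := (hRel α β).mp h
    exact (hRel β α).mpr ⟨τ, σ, U', U, hU', hU, ⟨e.symm⟩⟩
  have equiv_of_map : ∀ γ δ (g : F ⊗[k] Wfam γ →ₗ[k] F ⊗[k] Wfam δ),
      (∀ (x : 𝔤) v, g ⁅(1 : F) ⊗ₜ[k] x, v⁆ = ⁅(1 : F) ⊗ₜ[k] x, g v⁆) → g ≠ 0 →
      Nonempty (Wfam γ ≃ₗ⁅k,𝔤⁆ Wfam δ) := fun γ δ g hg hne => by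
    obtain ⟨f, hf⟩ := exists_lieModuleHom_ne_zero g hg hne
    exact f.nonempty_equiv_of_isAtom (hWatom γ) (hWatom δ) hf
  have eq_of_equiv : ∀ i j, Nonempty (Wfam (γfun i) ≃ₗ⁅k,𝔤⁆ Wfam (γfun j)) → i = j := by
    rintro i j ⟨φ⟩
    have h : Rel (rep i) (rep j) := (hRel _ _).mpr <|
      galConjIso_of_equiv (hWatom _) (p _) (hp₁ _) φ (hVatom _) (hVatom _) (hγfun i) (hγfun j)
        (π _) (hπ₁ _)
    exact (hrep (rep i)).unique (rel_refl _) h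
  have proj_rep : ∀ i, ∀ v ∈ Vfam (rep i), ∃ z : F ⊗[k] Wfam (γfun i),
      (Wfam (γfun i)).incl.extendScalars F z = v ∧ (p (γfun i)).extendScalars F v = z := by
    intro i v hv
    obtain ⟨z, rfl⟩ := LieSubmodule.exists_extendScalars_incl_eq (hγfun i hv)
    exact ⟨z, rfl, LieModuleHom.extendScalars_eq_of_leftInverse
      (f := (Wfam (γfun i)).incl) (g := p (γfun i)) (hp₁ _) z⟩
  have exists_class : ∀ γ, ∃ i, Nonempty (Wfam γ ≃ₗ⁅k,𝔤⁆ Wfam (γfun i)) := by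
    intro γ
    obtain ⟨w, hw, hw0⟩ := (Wfam γ).exists_mem_ne_zero_of_ne_bot (hWatom γ).1
    have hne : (1 : F) ⊗ₜ[k] w ≠ 0 := fun h => hw0 <|
      Module.FaithfullyFlat.tensorProduct_mk_injective (A := k) (B := F) W (by simpa using h)
    obtain ⟨α, hα⟩ : ∃ α, π α ((1 : F) ⊗ₜ[k] w) ≠ 0 := by
      by_contra! h
      refine hne ?_
      rw [← hπ₃ ((1 : F) ⊗ₜ[k] w)]
      exact Finset.sum_eq_zero fun α _ => by rw [h]; rfl
    obtain ⟨i, hi, -⟩ := hrep α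
    obtain ⟨σ, τ, hστ⟩ := (hRel _ _).mp hi
    obtain ⟨χ, hχ⟩ := hστ.exists_linearEquiv
    refine ⟨i, equiv_of_map γ (γfun i)
      ((((p (γfun i)).extendScalars F : F ⊗[k] W →ₗ[F] F ⊗[k] Wfam (γfun i)) ∘ₗ
        ((Vfam (rep i)).incl : Vfam (rep i) →ₗ[F] F ⊗[k] W)).restrictScalars k ∘ₗ
        χ.toLinearMap ∘ₗ
        ((π α : F ⊗[k] W →ₗ[F] Vfam α) ∘ₗ ((Wfam γ).incl.extendScalars F :
          F ⊗[k] Wfam γ →ₗ[F] F ⊗[k] W)).restrictScalars k)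
      (fun x v => ?_) fun h => ?_⟩
    · change (p (γfun i)).extendScalars F ((Vfam (rep i)).incl
        (χ (π α ((Wfam γ).incl.extendScalars F _)))) = ⁅_, (p (γfun i)).extendScalars F
          ((Vfam (rep i)).incl (χ (π α ((Wfam γ).incl.extendScalars F _))))⁆
      rw [LieModuleHom.map_lie, LieModuleHom.map_lie, hχ, LieModuleHom.map_lie,
        LieModuleHom.map_lie]
    · have h0 : (p (γfun i)).extendScalars F
        (χ (π α ((1 : F) ⊗ₜ[k] w)) : F ⊗[k] W) = 0 := congr($h ((1 : F) ⊗ₜ ⟨w, hw⟩))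
      obtain ⟨z, hz, hz'⟩ := proj_rep i _ (χ (π α ((1 : F) ⊗ₜ[k] w))).2
      rw [← hz', h0, map_zero] at hz
      exact hα (χ.map_eq_zero_iff.mp (Subtype.ext hz.symm))
  have proj_eq_zero : ∀ α i γ, Rel α (rep i) → ¬ Nonempty (Wfam (γfun i) ≃ₗ⁅k,𝔤⁆ Wfam γ) →
      ∀ v ∈ Vfam α, (p γ).extendScalars F v = 0 := by
    intro α i γ hα hγ v hv
    obtain ⟨σ, τ, hστ⟩ := (hRel _ _).mp (rel_symm _ _ hα)
    obtain ⟨χ, hχ⟩ := hστ.exists_linearEquiv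
    by_contra hne
    refine hγ (equiv_of_map (γfun i) γ
      ((((p γ).extendScalars F : F ⊗[k] W →ₗ[F] F ⊗[k] Wfam γ) ∘ₗ
        ((Vfam α).incl : Vfam α →ₗ[F] F ⊗[k] W)).restrictScalars k ∘ₗ χ.toLinearMap ∘ₗ
        ((π (rep i) : F ⊗[k] W →ₗ[F] Vfam (rep i)) ∘ₗ ((Wfam (γfun i)).incl.extendScalars F :
          F ⊗[k] Wfam (γfun i) →ₗ[F] F ⊗[k] W)).restrictScalars k)
      (fun x v => ?_) fun h => ?_)
    · change (p γ).extendScalars F ((Vfam α).incl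
        (χ (π (rep i) ((Wfam (γfun i)).incl.extendScalars F _)))) = ⁅_, (p γ).extendScalars F
          ((Vfam α).incl (χ (π (rep i) ((Wfam (γfun i)).incl.extendScalars F _))))⁆
      rw [LieModuleHom.map_lie, LieModuleHom.map_lie, hχ, LieModuleHom.map_lie,
        LieModuleHom.map_lie]
    · obtain ⟨z, hz, -⟩ := proj_rep i _ (χ.symm ⟨v, hv⟩).2
      have h0 : (p γ).extendScalars F
        (χ (π (rep i) ((Wfam (γfun i)).incl.extendScalars F z)) : F ⊗[k] W) = 0 :=
          congr($h z)
      rw [hz, hπ₁, LinearEquiv.apply_symm_apply] at h0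
      exact hne h0
  choose c hc using exists_class
  have c_γfun : ∀ i, c (γfun i) = i := fun i => (eq_of_equiv _ _ (hc (γfun i))).symm
  choose a ha using fun α => (hrep α).exists
  have a_eq_iff : ∀ α i, Rel (rep i) α ↔ a α = i := fun α i =>
    ⟨fun h => (hrep α).unique (ha α) (rel_symm _ _ h), fun h => h ▸ rel_symm _ _ (ha α)⟩
  let w : Fin t → ℕ := fun i => Module.finrank k (Wfam (γfun i))
  let n : Fin t → ℕ := fun i => Fintype.card {γ // c γ = i}
  let d : Fin t → ℕ := fun i => ∑ α : {α // a α = i}, Module.finrank F (Vfam α)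
  have w_pos : ∀ i, 0 < w i := fun i => by
    obtain ⟨v, hv, hv0⟩ := (Wfam (γfun i)).exists_mem_ne_zero_of_ne_bot (hWatom _).1
    exact Module.finrank_pos_iff_exists_ne_zero.mpr ⟨⟨v, hv⟩, fun h => hv0 congr(($h : W))⟩
  have w_eq : ∀ γ i, c γ = i → Module.finrank k (Wfam γ) = w i := fun γ i h => by
    subst h
    exact (hc γ).some.toLinearEquiv.finrank_eq
  have d_le : ∀ i, d i ≤ n i * w i := by
    intro i
    let f : (∀ α : {α // a α = i}, Vfam α) →ₗ[F] ∀ γ : {γ // c γ = i}, F ⊗[k] Wfam γ :=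
      LinearMap.pi fun γ => ((p γ).extendScalars F : F ⊗[k] W →ₗ[F] F ⊗[k] Wfam γ) ∘ₗ
        ∑ α : {α // a α = i}, ((Vfam α.1).incl : Vfam α.1 →ₗ[F] F ⊗[k] W) ∘ₗ LinearMap.proj α
    have hf_apply : ∀ v γ, f v γ = (p γ).extendScalars F (∑ α, (v α : F ⊗[k] W)) :=
      fun v γ => by
        change (p γ).extendScalars F ((∑ α : {α // a α = i},
          ((Vfam α.1).incl : Vfam α.1 →ₗ[F] F ⊗[k] W) ∘ₗ LinearMap.proj α) v) = _
        rw [LinearMap.sum_apply]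
        rfl
    have hf : Function.Injective f := by
      refine (injective_iff_map_eq_zero f).mpr fun v hv => ?_
      have hzero : ∀ γ, (p γ).extendScalars F (∑ α, (v α : F ⊗[k] W)) = 0 := fun γ => by
        by_cases hγ : c γ = i
        · rw [← hf_apply v ⟨γ, hγ⟩, hv]
          rfl
        · rw [map_sum]
          refine Finset.sum_eq_zero fun α _ =>
            proj_eq_zero α i γ (by simpa only [α.2] using ha α.1) ?_ _ (v α).2
          rintro ⟨e⟩
          exact hγ (eq_of_equiv _ _ ⟨e.trans (hc γ).some⟩).symm
      have hsum : ∀ y : F ⊗[k] W,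
          ∑ γ, (Wfam γ).incl.extendScalars F ((p γ).extendScalars F y) = y := fun y => by
        induction y using TensorProduct.induction_on with
        | zero => simp
        | add v w hv hw => simp only [map_add, Finset.sum_add_distrib, hv, hw]
        | tmul b w =>
          simp only [LieModuleHom.extendScalars_tmul, ← TensorProduct.tmul_sum]
          exact congrArg _ (hp₃ w)
      have htotal : ∑ α, (v α : F ⊗[k] W) = 0 := by
        rw [← hsum (∑ α, (v α : F ⊗[k] W))]
        exact Finset.sum_eq_zero fun γ _ => by rw [hzero, map_zero]
      funext β
      have h := congrArg (π β) htotal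
      rw [map_sum, map_zero, Finset.sum_eq_single β
        (fun α _ hα => hπ₂ _ _ _ fun h => hα (Subtype.ext h.symm)) (by simp), hπ₁] at h
      exact h
    calc d i = Module.finrank F (∀ α : {α // a α = i}, Vfam α) :=
          (Module.finrank_pi_fintype F).symm
      _ ≤ Module.finrank F (∀ γ : {γ // c γ = i}, F ⊗[k] Wfam γ) :=
          LinearMap.finrank_le_finrank_of_injective hf
      _ = n i * w i := by
        rw [Module.finrank_pi_fintype, Finset.sum_congr rfl fun γ _ =>
          (Module.finrank_baseChange (R := F)).trans (w_eq γ.1 i γ.2)]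
        simp [n]
  have sum_d : ∑ i, d i = ∑ i, n i * w i := by
    calc ∑ i, d i = ∑ α, Module.finrank F (Vfam α) :=
          Fintype.sum_fiberwise a fun α => Module.finrank F (Vfam α)
      _ = Module.finrank F (F ⊗[k] W) := (LieSubmodule.finrank_eq_sum hVindep hVsup).symm
      _ = Module.finrank k W := Module.finrank_baseChange
      _ = ∑ γ, Module.finrank k (Wfam γ) := LieSubmodule.finrank_eq_sum hWindep hWsup
      _ = ∑ i, ∑ γ : {γ // c γ = i}, Module.finrank k (Wfam γ) :=
          (Fintype.sum_fiberwise c fun γ => Module.finrank k (Wfam γ)).symm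
      _ = ∑ i, n i * w i := Finset.sum_congr rfl fun i _ => by
          rw [Finset.sum_congr rfl fun γ _ => w_eq γ.1 i γ.2]
          simp [n]
  have d_eq : ∀ i, d i = n i * w i := fun i =>
    (Finset.sum_eq_sum_iff_of_le fun i _ => d_le i).mp sum_d i (Finset.mem_univ i)
  have finsum_eq : ∀ i, ∑ᶠ α ∈ {α' : A | Rel (rep i) α'}, Module.finrank F (Vfam α) =
      n i * w i := fun i => by
    rw [← d_eq, finsum_mem_eq_finite_toFinset_sum _ (Set.toFinite _)]
    exact Finset.sum_subtype _ (fun α => by simp [a_eq_iff]) _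
  have m_eq : ∀ i, m i = n i := fun i => by
    rw [hm, finsum_eq]
    exact Nat.mul_div_cancel _ (w_pos i)
  refine ⟨fun i j hij => ⟨fun e => hij (eq_of_equiv i j ⟨e⟩)⟩,
    fun i d hd => lieEnd_isUnit_of_isAtom (hWatom _) d hd, fun i => ⟨?_, ?_⟩, ?_⟩
  · rw [m_eq]
    exact Fintype.card_pos_iff.mpr ⟨⟨γfun i, c_γfun i⟩⟩
  · rw [finsum_eq]
    exact Dvd.intro_left _ rfl
  · let θ : ∀ i (γ : {γ // c γ = i}), Wfam γ ≃ₗ⁅k,𝔤⁆ Wfam (γfun i) := fun i γ =>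
      Classical.choice (by obtain ⟨γ, rfl⟩ := γ; exact hc γ)
    let e : ∀ i, Fin (m i) ≃ {γ // c γ = i} := fun i =>
      (Fintype.equivFinOfCardEq (m_eq i).symm).symm
    refine nonempty_lieEnd_algEquiv_pi_matrix m (fun i => Wfam (γfun i))
      (fun i b => (Wfam (e i b)).incl.comp (θ i (e i b)).symm.toLieModuleHom)
      (fun i b => (θ i (e i b)).toLieModuleHom.comp (p (e i b))) (fun i b x => ?_)
      (fun i b b' x hb => ?_) (fun i j hij f => ?_) fun v => ?_
    · change θ i (e i b) (p (e i b) ((θ i (e i b)).symm x : Wfam (e i b))) = x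
      rw [hp₁, LieModuleEquiv.apply_symm_apply]
    · change θ i (e i b) (p (e i b) ((θ i (e i b')).symm x : Wfam (e i b'))) = 0
      rw [hp₂ _ _ _ fun h => hb ((e i).injective (Subtype.ext h))]
      exact (θ i (e i b)).toLieModuleHom.map_zero
    · by_contra hf
      exact hij (eq_of_equiv i j (f.nonempty_equiv_of_isAtom (hWatom _) (hWatom _) hf))
    · change ∑ i, ∑ b, ((θ i (e i b)).symm (θ i (e i b) (p (e i b) v)) : W) = v
      simp only [LieModuleEquiv.symm_apply_apply]
      conv_rhs => rw [← hp₃ v, ← Fintype.sum_fiberwise c]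
      exact Finset.sum_congr rfl fun i _ => (e i).sum_comp fun γ => (p γ v : W)
end

section
/- The field F = ℚ(z₁, z₂, z₃) is a Galois extension of ℚ of degree 24, and Gal(F/ℚ) is nonabelian and isomorphic to the semidirect product (ℤ/2ℤ)³ ⋊ ℤ/3ℤ, where a generator of ℤ/3ℤ acts on (ℤ/2ℤ)³ by cyclic permutation of the three factors. -/
/-- Cyclic shift of the coordinates of `(ℤ/2ℤ)³` (indices in `ℤ/3ℤ`), as a multiplicative
automorphism. -/
def cycMulAut (kk : ZMod 3) : MulAut (Multiplicative (ZMod 3 → ZMod 2)) where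
  toFun f := Multiplicative.ofAdd (fun i => Multiplicative.toAdd f (i + kk))
  invFun f := Multiplicative.ofAdd (fun i => Multiplicative.toAdd f (i - kk))
  left_inv f := by
    apply Multiplicative.toAdd.injective
    funext i
    simp
  right_inv f := by
    apply Multiplicative.toAdd.injective
    funext i
    simp
  map_mul' f g := by
    apply Multiplicative.toAdd.injective
    funext i
    simp

/-- The action of `ℤ/3ℤ` on `(ℤ/2ℤ)³` by cyclic permutation of the three factors. -/
def cycHom : Multiplicative (ZMod 3) →* MulAut (Multiplicative (ZMod 3 → ZMod 2)) :=
  MonoidHom.mk' (fun kk => cycMulAut (Multiplicative.toAdd kk)) (fun a b => by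
    refine MulEquiv.ext fun f => ?_
    apply Multiplicative.toAdd.injective
    funext i
    simp [cycMulAut, add_assoc])

/-- The semidirect product `(ℤ/2ℤ)³ ⋊ ℤ/3ℤ` for the cyclic permutation action. -/
abbrev CycProd : Type :=
  Multiplicative (ZMod 3 → ZMod 2) ⋊[cycHom] Multiplicative (ZMod 3)

/-- An automorphism `g` acts on the family `z` as the signed cyclic permutation `x`. -/
def ActsAs {L : Type*} [Field L] [Algebra ℚ L] (z : ZMod 3 → L) (x : CycProd)
    (g : L ≃ₐ[ℚ] L) : Prop :=
  ∀ i, g (z (i + x.right.toAdd)) = (-1) ^ (x.left.toAdd i).val * z i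

lemma neg_one_pow_val_add {R : Type*} [CommRing R] (a b : ZMod 2) :
    (-1 : R) ^ (a + b).val = (-1) ^ a.val * (-1) ^ b.val := by
  rw [← pow_add, ZMod.val_add, ← neg_one_pow_eq_pow_mod_two]

lemma CycProd.mul_left_apply (x y : CycProd) (i : ZMod 3) :
    (x * y).left.toAdd i = x.left.toAdd i + y.left.toAdd (i + x.right.toAdd) := rfl

lemma CycProd.mul_right_toAdd (x y : CycProd) :
    (x * y).right.toAdd = x.right.toAdd + y.right.toAdd := rfl

lemma CycProd.conj_inl_single (x : CycProd) (i : ZMod 3) :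
    x * SemidirectProduct.inl (Multiplicative.ofAdd (Pi.single i 1)) * x⁻¹ =
      SemidirectProduct.inl (Multiplicative.ofAdd (Pi.single (i - x.right.toAdd) 1)) := by
  rw [mul_inv_eq_iff_eq_mul]
  apply SemidirectProduct.ext
  · apply Multiplicative.toAdd.injective
    funext j
    rw [CycProd.mul_left_apply, CycProd.mul_left_apply]
    simp [Pi.single_apply, eq_sub_iff_add_eq, add_comm]
  · simp

/-- A subgroup containing a sign change in one coordinate and an element which moves the
coordinates is everything. -/
lemma CycProd.eq_top_of_mem (H : Subgroup CycProd)
    (hs : SemidirectProduct.inl (Multiplicative.ofAdd (Pi.single 0 1)) ∈ H)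
    (h : CycProd) (hh : h ∈ H) (hr : h.right.toAdd ≠ 0) : H = ⊤ := by
  have gen : ∀ k j : ZMod 3, k ≠ 0 → ∃ n : ℕ, j = n * k := by
    intro k j hk
    refine ⟨(j / k).val, ?_⟩
    rw [ZMod.natCast_zmod_val]
    have : Fact (Nat.Prime 3) := ⟨Nat.prime_three⟩
    field_simp
  have hpow : ∀ n : ℕ, (h ^ n).right.toAdd = n * h.right.toAdd := by
    intro n
    induction n with
    | zero => simp
    | succ n ih => rw [pow_succ, CycProd.mul_right_toAdd, ih]; push_cast; ring
  have hsingle : ∀ j : ZMod 3,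
      SemidirectProduct.inl (Multiplicative.ofAdd (Pi.single j 1)) ∈ H := by
    intro j
    obtain ⟨n, hn⟩ := gen _ (-j) hr
    have := H.mul_mem (H.mul_mem (H.pow_mem hh n) hs) (H.inv_mem (H.pow_mem hh n))
    rw [CycProd.conj_inl_single, hpow, ← hn] at this
    simpa using this
  have hinl : ∀ f : Multiplicative (ZMod 3 → ZMod 2), SemidirectProduct.inl f ∈ H := by
    intro f
    have hf : f = ∏ j : ZMod 3, (Multiplicative.ofAdd (Pi.single j 1)) ^ (f.toAdd j).val := by
      apply Multiplicative.toAdd.injective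
      funext i
      simp [toAdd_prod, Finset.sum_apply, Pi.single_apply, -nsmul_eq_mul, smul_ite]
    rw [← Subgroup.mem_comap, hf]
    exact Subgroup.prod_mem _ fun j _ => Subgroup.pow_mem (H.comap _) (hsingle j) _
  rw [eq_top_iff]
  intro x _
  obtain ⟨n, hn⟩ := gen _ x.right.toAdd hr
  have hx : x * (h ^ n)⁻¹ = SemidirectProduct.inl (x * (h ^ n)⁻¹).left := by
    apply SemidirectProduct.ext
    · simp
    · rw [SemidirectProduct.mul_right, SemidirectProduct.inv_right,
        SemidirectProduct.right_inl, mul_inv_eq_one]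
      apply Multiplicative.toAdd.injective
      rw [hpow, ← hn]
  have := H.mul_mem (hinl (x * (h ^ n)⁻¹).left) (H.pow_mem hh n)
  rwa [← hx, inv_mul_cancel_right] at this

section Roots

variable {L : Type*} [Field L] [Algebra ℚ L] {z : ZMod 3 → L}

lemma ActsAs.mul {x y : CycProd} {g h : L ≃ₐ[ℚ] L} (hg : ActsAs z x g) (hh : ActsAs z y h) :
    ActsAs z (x * y) (g * h) := by
  intro i
  rw [CycProd.mul_right_toAdd, CycProd.mul_left_apply, ← add_assoc, AlgEquiv.mul_apply, hh,
    map_mul, map_pow, map_neg, map_one, hg, neg_one_pow_val_add]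
  ring

omit [Algebra ℚ L] in
lemma eq_of_neg_one_pow_mul_eq [CharZero L] {a b : ZMod 2} {w : L} (hw : w ≠ 0)
    (h : (-1) ^ a.val * w = (-1) ^ b.val * w) : a = b := by
  have h' := mul_right_cancel₀ hw h
  fin_cases a <;> fin_cases b <;> first | rfl | (exfalso; norm_num [ZMod.val] at h')

lemma ActsAs.unique {x y : CycProd} {g : L ≃ₐ[ℚ] L}
    (hinj : ∀ i j, z i ^ 2 = z j ^ 2 → i = j) (hne : ∀ i, z i ≠ 0)
    (hx : ActsAs z x g) (hy : ActsAs z y g) : x = y := by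
  have : CharZero L := algebraRat.charZero L
  have hsq : ∀ {x : CycProd}, ActsAs z x g → ∀ i, g (z (i + x.right.toAdd) ^ 2) = z i ^ 2 := by
    intro x hx i
    rw [map_pow, hx i, mul_pow, ← pow_mul, mul_comm _ 2, pow_mul]
    simp
  have hright : x.right.toAdd = y.right.toAdd := by
    have h := (hsq hx 0).trans (hsq hy 0).symm
    simpa using hinj _ _ (g.injective h)
  apply SemidirectProduct.ext
  · apply Multiplicative.toAdd.injective
    funext i
    refine eq_of_neg_one_pow_mul_eq (hne i) ?_
    rw [← hx i, ← hy i, hright]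
  · exact Multiplicative.toAdd.injective hright

lemma exists_actsAs (hcyc : ∀ i, z (i + 1) ^ 2 * (1 - z i ^ 2) = 1)
    (hroot : ∀ i, (z i ^ 2) ^ 3 - 3 * z i ^ 2 + 1 = 0)
    (hroots : ∀ w : L, w ^ 3 - 3 * w + 1 = 0 → ∃ j, w = z j ^ 2) (g : L ≃ₐ[ℚ] L) :
    ∃ x, ActsAs z x g := by
  obtain ⟨j, hj⟩ := hroots (g (z 0 ^ 2)) (by
    simpa only [map_add, map_sub, map_mul, map_pow, map_one, map_zero, map_ofNat]
      using congrArg g (hroot 0))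
  have step : ∀ n : ℕ, g (z n ^ 2) = z (n + j) ^ 2 := by
    intro n
    induction n with
    | zero => simpa using hj
    | succ n ih =>
      have h1 := congrArg g (hcyc n)
      rw [map_mul, map_sub, map_one, ih] at h1
      have h2 := hcyc (n + j)
      have h3 : (1 - z (n + j) ^ 2) ≠ 0 := right_ne_zero_of_mul_eq_one h2
      push_cast
      rw [add_right_comm]
      exact mul_right_cancel₀ h3 (h1.trans h2.symm)
  have hsq : ∀ i, ∃ e : ZMod 2, g (z (i + -j)) = (-1) ^ e.val * z i := by
    intro i
    have h := step (i + -j).val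
    rw [ZMod.natCast_zmod_val, neg_add_cancel_right, map_pow] at h
    rcases sq_eq_sq_iff_eq_or_eq_neg.mp h with h | h
    · exact ⟨0, by simpa using h⟩
    · exact ⟨1, by simpa [ZMod.val_one] using h⟩
  choose e he using hsq
  exact ⟨⟨Multiplicative.ofAdd e, Multiplicative.ofAdd (-j)⟩, he⟩

/-- The automorphism group of a field generated by square roots `z i` of the roots of
`X³ - 3X + 1` is the full group of signed cyclic permutations, as soon as it contains
a single sign change and does not fix all the roots of the cubic. -/
lemma nonempty_mulEquiv_cycProd (hcyc : ∀ i, z (i + 1) ^ 2 * (1 - z i ^ 2) = 1)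
    (hroot : ∀ i, (z i ^ 2) ^ 3 - 3 * z i ^ 2 + 1 = 0)
    (hroots : ∀ w : L, w ^ 3 - 3 * w + 1 = 0 → ∃ j, w = z j ^ 2)
    (hgen : ∀ g : L ≃ₐ[ℚ] L, (∀ i, g (z i) = z i) → g = 1)
    (c : L ≃ₐ[ℚ] L) (hc : ∀ i, c (z i) = if i = 0 then - z i else z i)
    (t : L ≃ₐ[ℚ] L) (ht : t (z 0 ^ 2) ≠ z 0 ^ 2) :
    Nonempty ((L ≃ₐ[ℚ] L) ≃* CycProd) := by
  have : CharZero L := algebraRat.charZero L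
  have hne : ∀ i, z i ≠ 0 := fun i h => by simpa [h] using hroot i
  have hsucc : ∀ i, z i ^ 2 ≠ z (i + 1) ^ 2 := by
    intro i h
    have h1 := hcyc i
    rw [← h] at h1
    have h2 : 3 * z i ^ 2 = 0 := by
      linear_combination (-1) * hroot i - (z i ^ 2 + 1) * h1
    exact hne i (by simpa using h2)
  have hinj : ∀ i j, z i ^ 2 = z j ^ 2 → i = j := by
    intro i j h
    have : ∀ i j : ZMod 3, i = j ∨ j = i + 1 ∨ i = j + 1 := by decide
    rcases this i j with h' | rfl | rfl
    · exact h'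
    · exact absurd h (hsucc i)
    · exact absurd h.symm (hsucc j)
  choose f hf using exists_actsAs hcyc hroot hroots
  let φ : (L ≃ₐ[ℚ] L) →* CycProd :=
    MonoidHom.mk' f fun g h => (hf (g * h)).unique hinj hne ((hf g).mul (hf h))
  refine ⟨MulEquiv.ofBijective φ ⟨?_, ?_⟩⟩
  · rw [injective_iff_map_eq_one]
    intro g hg
    refine hgen g fun i => ?_
    have h := hf g i
    rw [show f g = 1 from hg] at h
    simpa using h
  · rw [← MonoidHom.range_eq_top]
    refine CycProd.eq_top_of_mem _ ⟨c, ?_⟩ (φ t) ⟨t, rfl⟩ ?_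
    · refine (hf c).unique hinj hne fun i => ?_
      by_cases hi : i = 0
      · simp [hc, hi, ZMod.val_one]
      · simp [hc, hi]
    · intro h0
      apply ht
      have h := hf t 0
      rw [show (f t).right.toAdd = 0 from h0, add_zero] at h
      rw [map_pow, h, mul_pow, ← pow_mul, mul_comm _ 2, pow_mul]
      simp

end Roots

lemma cubic_factor {K : Type*} [Field K] {a b c : K} (ha : a ^ 3 - 3 * a + 1 = 0)
    (hab : b * (1 - a) = 1) (hca : a * (1 - c) = 1) (w : K) :
    w ^ 3 - 3 * w + 1 = (w - a) * (w - b) * (w - c) := by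
  have ha' : 1 - a ≠ 0 := right_ne_zero_of_mul_eq_one hab
  have ha0 : a ≠ 0 := left_ne_zero_of_mul_eq_one hca
  have hb : b = 2 - a - a ^ 2 :=
    mul_right_cancel₀ ha' (by linear_combination hab - ha)
  have hc : c = a ^ 2 - 2 :=
    mul_left_cancel₀ ha0 (by linear_combination -hca - ha)
  subst hb hc
  linear_combination (w * (a + 1) - (a ^ 2 + a - 1)) * ha

lemma cubic_rat_ne_zero (q : ℚ) : q ^ 3 - 3 * q + 1 ≠ 0 := by
  intro h
  have hi : IsIntegral ℤ q := by
    refine ⟨.X ^ 3 - 3 * .X + 1, by monicity!, ?_⟩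
    simpa using h
  obtain ⟨n, rfl⟩ := IsIntegrallyClosed.isIntegral_iff.mp hi
  have hn : n * (3 - n ^ 2) = 1 := by
    simp only [eq_intCast] at h
    have : (n : ℚ) * (3 - n ^ 2) = 1 := by linear_combination -h
    exact_mod_cast this
  rcases Int.eq_one_or_neg_one_of_mul_eq_one hn with rfl | rfl <;> norm_num at hn

lemma CycProd.exists_mul_ne : ∃ a b : CycProd, a * b ≠ b * a := by
  refine ⟨SemidirectProduct.inl (Multiplicative.ofAdd (Pi.single 0 1)),
    SemidirectProduct.inr (Multiplicative.ofAdd 1), fun h => ?_⟩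
  have := congrArg (fun x : CycProd => x.left.toAdd 0) h
  simp only [CycProd.mul_left_apply] at this
  revert this
  decide

lemma CycProd.natCard : Nat.card CycProd = 24 := by
  rw [SemidirectProduct.card]
  simp [Nat.card_eq_fintype_card]

lemma conj_eq_neg_of_sq_neg {w : ℂ} {r : ℝ} (h : w ^ 2 = r) (hr : r < 0) :
    (starRingEnd ℂ) w = -w := by
  have h' := congrArg (starRingEnd ℂ) h
  rw [map_pow, Complex.conj_ofReal, ← h] at h'
  refine (sq_eq_sq_iff_eq_or_eq_neg.mp h').resolve_left fun hw => ?_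
  obtain ⟨s, rfl⟩ := Complex.conj_eq_iff_real.mp hw
  have : s ^ 2 = r := by exact_mod_cast h
  nlinarith [sq_nonneg s]

lemma conj_eq_of_sq_pos {w : ℂ} {r : ℝ} (h : w ^ 2 = r) (hr : 0 < r) :
    (starRingEnd ℂ) w = w := by
  have h1 : (Complex.I * w) ^ 2 = (-r : ℝ) := by
    rw [mul_pow, Complex.I_sq, h]; push_cast; ring
  have h2 := conj_eq_neg_of_sq_neg h1 (neg_lt_zero.mpr hr)
  rw [map_mul, Complex.conj_I] at h2
  exact mul_left_cancel₀ (neg_ne_zero.mpr Complex.I_ne_zero) (by linear_combination h2)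

lemma isGalois_adjoin_range {z : ZMod 3 → ℂ}
    (hfac : ∀ w : ℂ, w ^ 3 - 3 * w + 1 = (w - z 0 ^ 2) * (w - z 1 ^ 2) * (w - z 2 ^ 2)) :
    FiniteDimensional ℚ (IntermediateField.adjoin ℚ (Set.range z)) ∧
      IsGalois ℚ (IntermediateField.adjoin ℚ (Set.range z)) := by
  set q : Polynomial ℚ := .X ^ 6 - 3 * .X ^ 2 + 1 with hq
  have hq0 : q ≠ 0 := by
    have : q.Monic := by rw [hq]; monicity!
    exact this.ne_zero
  have hmem : ∀ w : ℂ, w ∈ q.rootSet ℂ ↔ ∃ i, w = z i ∨ w = - z i := by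
    intro w
    have h6 : w ^ 6 - 3 * w ^ 2 + 1 = (w ^ 2) ^ 3 - 3 * w ^ 2 + 1 := by ring
    have hex : ∀ P : ZMod 3 → Prop, (∃ i, P i) ↔ (P 0 ∨ P 1) ∨ P 2 := fun P =>
      ⟨fun ⟨i, hi⟩ => by fin_cases i <;> tauto, by rintro ((h | h) | h) <;> exact ⟨_, h⟩⟩
    rw [Polynomial.mem_rootSet_of_ne hq0, hex]
    simp only [hq, map_add, map_sub, map_mul, map_pow, map_one, map_ofNat, Polynomial.aeval_X]
    rw [h6, hfac]
    simp only [mul_eq_zero, sub_eq_zero, sq_eq_sq_iff_eq_or_eq_neg]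
  have hadj : IntermediateField.adjoin ℚ (Set.range z) =
      IntermediateField.adjoin ℚ (q.rootSet ℂ) := by
    apply le_antisymm <;> rw [IntermediateField.adjoin_le_iff]
    · rintro _ ⟨i, rfl⟩
      exact IntermediateField.subset_adjoin _ _ ((hmem _).mpr ⟨i, .inl rfl⟩)
    · intro w hw
      obtain ⟨i, rfl | rfl⟩ := (hmem w).mp hw
      · exact IntermediateField.subset_adjoin _ _ ⟨i, rfl⟩
      · exact neg_mem (IntermediateField.subset_adjoin _ _ ⟨i, rfl⟩)
  have hsplit := IntermediateField.adjoin_rootSet_isSplittingField (p := q)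
    (IsAlgClosed.splits (q.map (algebraMap ℚ ℂ)))
  have : Normal ℚ (IntermediateField.adjoin ℚ (q.rootSet ℂ)) := Normal.of_isSplittingField (hFEp := hsplit)
  rw [hadj]
  exact ⟨@Polynomial.IsSplittingField.finiteDimensional _ _ _ _ _ q hsplit, ⟨⟩⟩

/-- `F = ℚ(z₁, z₂, z₃)` is Galois over `ℚ` of degree `24`, with
`Gal(F/ℚ)` nonabelian and isomorphic to `(ℤ/2ℤ)³ ⋊ ℤ/3ℤ`, a generator of `ℤ/3ℤ` acting by
cyclic permutation of the three factors. -/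
theorem stmt12 (ρ ρ₂ ρ₃ : ℝ) (hρroot : ρ ^ 3 - 3 * ρ + 1 = 0) (hρneg : ρ < 0)
    (hρ₂ : ρ₂ = 1 / (1 - ρ)) (hρ₃ : ρ₃ = 1 - 1 / ρ)
    (z₁ z₂ z₃ : ℂ) (hz₁ : z₁ ^ 2 = (ρ : ℂ)) (hz₂ : z₂ ^ 2 = (ρ₂ : ℂ)) (hz₃ : z₃ ^ 2 = (ρ₃ : ℂ))
    (F : IntermediateField ℚ ℂ) (hF : F = IntermediateField.adjoin ℚ {z₁, z₂, z₃}) :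
    IsGalois ℚ F ∧
    Module.finrank ℚ F = 24 ∧
    (∃ a b : F ≃ₐ[ℚ] F, a * b ≠ b * a) ∧
    Nonempty ((F ≃ₐ[ℚ] F) ≃*
      (Multiplicative (ZMod 3 → ZMod 2) ⋊[cycHom] Multiplicative (ZMod 3))) := by
  have h0 : ρ ≠ 0 := hρneg.ne
  have h1 : 1 - ρ ≠ 0 := by linarith
  have hρ₂pos : 0 < ρ₂ := by rw [hρ₂]; exact one_div_pos.mpr (by linarith)
  have hρ₃pos : 0 < ρ₃ := by
    rw [hρ₃]
    have := one_div_neg.mpr hρneg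
    linarith
  have c12 : ρ₂ * (1 - ρ) = 1 := by rw [hρ₂]; field_simp
  have c31 : ρ * (1 - ρ₃) = 1 := by rw [hρ₃]; field_simp; ring
  have c23 : ρ₃ * (1 - ρ₂) = 1 := by rw [hρ₃, hρ₂]; field_simp; ring
  let z : ZMod 3 → ℂ := ![z₁, z₂, z₃]
  have hrange : Set.range z = {z₁, z₂, z₃} := by
    change Set.range (![z₁, z₂, z₃] : Fin 3 → ℂ) = _
    ext w
    simp only [Matrix.range_cons, Matrix.range_empty, Set.mem_union, Set.mem_singleton_iff,
      Set.mem_insert_iff, Set.mem_empty_iff_false, or_false]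
  have hcyc : ∀ i, z (i + 1) ^ 2 * (1 - z i ^ 2) = 1 := by
    intro i
    fin_cases i
    · change z₂ ^ 2 * (1 - z₁ ^ 2) = 1
      rw [hz₁, hz₂]; exact_mod_cast c12
    · change z₃ ^ 2 * (1 - z₂ ^ 2) = 1
      rw [hz₂, hz₃]; exact_mod_cast c23
    · change z₁ ^ 2 * (1 - z₃ ^ 2) = 1
      rw [hz₁, hz₃]; exact_mod_cast c31
  have hroot₀ : (z 0 ^ 2) ^ 3 - 3 * z 0 ^ 2 + 1 = 0 := by
    change (z₁ ^ 2) ^ 3 - 3 * z₁ ^ 2 + 1 = 0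
    rw [hz₁]; exact_mod_cast hρroot
  have hfac := cubic_factor hroot₀ (hcyc 0) (hcyc 2)
  have hfac' : ∀ w : ℂ,
      w ^ 3 - 3 * w + 1 = (w - z 0 ^ 2) * (w - z 1 ^ 2) * (w - z 2 ^ 2) := hfac
  have hroot : ∀ i, (z i ^ 2) ^ 3 - 3 * z i ^ 2 + 1 = 0 := by
    intro i
    rw [hfac' (z i ^ 2)]
    have hi : ∀ i : ZMod 3, i = 0 ∨ i = 1 ∨ i = 2 := by decide
    rcases hi i with rfl | rfl | rfl <;> simp
  have hconj : ∀ i, (starRingEnd ℂ) (z i) = if i = 0 then - z i else z i := by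
    intro i
    fin_cases i
    · exact conj_eq_neg_of_sq_neg hz₁ hρneg
    · exact conj_eq_of_sq_pos hz₂ hρ₂pos
    · exact conj_eq_of_sq_pos hz₃ hρ₃pos
  rw [← hrange] at hF
  subst hF
  obtain ⟨hfin, hgal⟩ := isGalois_adjoin_range hfac'
  set F := IntermediateField.adjoin ℚ (Set.range z) with hF
  have hzF : ∀ i, z i ∈ F := fun i => IntermediateField.subset_adjoin _ _ ⟨i, rfl⟩
  let y : ZMod 3 → F := fun i => ⟨z i, hzF i⟩
  have hgen : ∀ g : F ≃ₐ[ℚ] F, (∀ i, g (y i) = y i) → g = 1 := by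
    intro g hg
    have hhom : (F.val.comp g.toAlgHom) = F.val := by
      refine IntermediateField.algHom_ext_of_eq_adjoin ℚ hF ?_
      rintro _ ⟨i, rfl⟩
      exact congrArg F.val (hg i)
    ext x
    exact DFunLike.congr_fun hhom x
  have hroots : ∀ w : F, w ^ 3 - 3 * w + 1 = 0 → ∃ j, w = y j ^ 2 := by
    intro w hw
    have h := congrArg F.val hw
    simp only [map_add, map_sub, map_mul, map_pow, map_one, map_ofNat, map_zero] at h
    rw [hfac'] at h
    simp only [mul_eq_zero, sub_eq_zero] at h
    rcases h with (h | h) | h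
    · exact ⟨0, Subtype.ext h⟩
    · exact ⟨1, Subtype.ext h⟩
    · exact ⟨2, Subtype.ext h⟩
  have hrootF : ∀ i, (y i ^ 2) ^ 3 - 3 * y i ^ 2 + 1 = 0 := fun i => Subtype.ext (hroot i)
  obtain ⟨t, ht⟩ : ∃ t : F ≃ₐ[ℚ] F, t (y 0 ^ 2) ≠ y 0 ^ 2 := by
    by_contra! hfix
    obtain ⟨q, hq⟩ := IntermediateField.mem_bot.mp ((IsGalois.mem_bot_iff_fixed _).mpr hfix)
    apply cubic_rat_ne_zero q
    apply (algebraMap ℚ F).injective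
    simpa only [map_add, map_sub, map_mul, map_pow, map_one, map_ofNat, map_zero, hq]
      using hrootF 0
  let c : F ≃ₐ[ℚ] F := (Complex.conjAe.restrictScalars ℚ).restrictNormal F
  have hc : ∀ i, c (y i) = if i = 0 then - y i else y i := by
    intro i
    apply (algebraMap F ℂ).injective
    refine ((Complex.conjAe.restrictScalars ℚ).restrictNormal_commutes F (y i)).trans ?_
    refine (hconj i).trans ?_
    split_ifs <;> rfl
  obtain ⟨e⟩ := nonempty_mulEquiv_cycProd (fun i => Subtype.ext (hcyc i)) hrootF hroots hgen
    c hc t ht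
  refine ⟨hgal, ?_, ?_, ⟨e⟩⟩
  · rw [← IsGalois.card_aut_eq_finrank, Nat.card_congr e.toEquiv, CycProd.natCard]
  · obtain ⟨a, b, hab⟩ := CycProd.exists_mul_ne
    refine ⟨e.symm a, e.symm b, fun h => hab ?_⟩
    rw [← map_mul, ← map_mul] at h
    exact e.symm.injective h
end
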